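/- Let γ ∈ [0,1), λ ∈ ℝ, and let f, g, h : ℕ → ℝ be cost functions with Bellman fixed points J_f, J_g, J_h : ℕ → ℝ such that the pairwise differences J_f − J_h and J_h − J_g are bounded. If |h(δ) − g(δ)| ≤ d for every δ ∈ ℕ and |f(δ) − g(δ)| ≤ β for every δ ∈ ℕ, then |f(δ) − h(δ)| ≤ β + d for every δ, and consequently |J_f(δ) − J_g(δ)| ≤ (2d + β)/(1 − γ) for every δ ∈ ℕ. -/

import Mathlib

/-- `J` is a Bellman fixed point for cost `f`. -/
def IsBellmanFixedPoint (γ lam : ℝ) (f J : ℕ → ℝ) : Prop :=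
  ∀ δ : ℕ, J δ = f δ + min (lam + γ * J 1) (γ * J (δ + 1))

/-- If `|h − g| ≤ d` and `|f − g| ≤ β` pointwise, then `|f − h| ≤ β + d` pointwise,
and the Bellman fixed points of `f` and `g` satisfy `|J_f − J_g| ≤ (2d + β)/(1 − γ)`. -/
theorem bellman_fixed_point_three_function_bound (γ lam : ℝ) (hγ0 : 0 ≤ γ) (hγ1 : γ < 1)
    (f g h Jf Jg Jh : ℕ → ℝ)
    (hJf : IsBellmanFixedPoint γ lam f Jf) (hJg : IsBellmanFixedPoint γ lam g Jg)
    (hJh : IsBellmanFixedPoint γ lam h Jh)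
    (hbdd₁ : ∃ C : ℝ, ∀ δ : ℕ, |Jf δ - Jh δ| ≤ C)
    (hbdd₂ : ∃ C : ℝ, ∀ δ : ℕ, |Jh δ - Jg δ| ≤ C)
    (d β : ℝ) (hhg : ∀ δ : ℕ, |h δ - g δ| ≤ d) (hfg : ∀ δ : ℕ, |f δ - g δ| ≤ β) :
    (∀ δ : ℕ, |f δ - h δ| ≤ β + d) ∧
      (∀ δ : ℕ, |Jf δ - Jg δ| ≤ (2 * d + β) / (1 - γ)) := by
  obtain ⟨C₁, hC₁⟩ := hbdd₁
  obtain ⟨C₂, hC₂⟩ := hbdd₂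
  refine ⟨fun δ => ?_, fun δ => ?_⟩
  · have h1 := abs_le.1 (hhg δ)
    have h2 := abs_le.1 (hfg δ)
    exact abs_le.2 ⟨by linarith, by linarith⟩
  · have hd : 0 ≤ d := (abs_nonneg _).trans (hhg 0)
    have hb : BddAbove (Set.range fun n => |Jf n - Jg n|) := by
      refine ⟨C₁ + C₂, ?_⟩
      rintro _ ⟨n, rfl⟩
      exact (abs_sub_le _ (Jh n) _).trans (add_le_add (hC₁ n) (hC₂ n))
    have hS : ∀ n, |Jf n - Jg n| ≤ ⨆ n, |Jf n - Jg n| := fun n => le_ciSup hb n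
    have hstep : (⨆ n, |Jf n - Jg n|) ≤ β + γ * ⨆ n, |Jf n - Jg n| := by
      refine ciSup_le fun n => ?_
      generalize (⨆ n, |Jf n - Jg n|) = S at hS
      have e1 : |γ * Jf 1 - γ * Jg 1| ≤ γ * S := by
        rw [← mul_sub, abs_mul, abs_of_nonneg hγ0]
        exact mul_le_mul_of_nonneg_left (hS 1) hγ0
      have e2 : |γ * Jf (n + 1) - γ * Jg (n + 1)| ≤ γ * S := by
        rw [← mul_sub, abs_mul, abs_of_nonneg hγ0]
        exact mul_le_mul_of_nonneg_left (hS (n + 1)) hγ0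
      have e3 := abs_min_sub_min_le_max (lam + γ * Jf 1) (γ * Jf (n + 1))
        (lam + γ * Jg 1) (γ * Jg (n + 1))
      rw [add_sub_add_left_eq_sub] at e3
      have e4 := e3.trans (max_le e1 e2)
      rw [hJf n, hJg n, add_sub_add_comm]
      exact (abs_add_le _ _).trans (add_le_add (hfg n) e4)
    rw [le_div_iff₀ (by linarith)]
    have := mul_le_mul_of_nonneg_right (hS δ) (by linarith : 0 ≤ 1 - γ)
    linarith
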